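/- Let L = ℚ[x]/(f) where f(x) = x¹⁷ − 2x¹⁶ + 12x¹⁵ − 28x¹⁴ + 60x¹³ − 160x¹² + 200x¹¹ − 500x¹⁰ + 705x⁹ − 886x⁸ + 2024x⁷ − 604x⁶ + 2146x⁵ + 80x⁴ − 1376x³ − 496x² − 1013x − 490. Then L is a number field of degree 17 over ℚ and the discriminant of its ring of integers equals 2⁴⁴ · 3⁶ · 17⁸ = 89462021750334834736103424. -/

import Mathlib

open Polynomial

/-- The degree-17 polynomial of van Bommel–Costa–Elkies–Keller–Schiavone–Voight. -/
noncomputable def f17 : Polynomial ℚ :=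
  X ^ 17 - 2 * X ^ 16 + 12 * X ^ 15 - 28 * X ^ 14 + 60 * X ^ 13 - 160 * X ^ 12 +
    200 * X ^ 11 - 500 * X ^ 10 + 705 * X ^ 9 - 886 * X ^ 8 + 2024 * X ^ 7 - 604 * X ^ 6 +
    2146 * X ^ 5 + 80 * X ^ 4 - 1376 * X ^ 3 - 496 * X ^ 2 - 1013 * X - 490

theorem exists_eq_C_mul_of_map_zmod_eq_zero {p : ℕ} {q : ℤ[X]}
    (hq : q.map (Int.castRingHom (ZMod p)) = 0) : ∃ s : ℤ[X], q = C (p : ℤ) * s := by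
  refine (C_dvd_iff_dvd_coeff _ _).2 fun i => ?_
  have := congrArg (fun r => r.coeff i) hq
  simpa [coeff_map, ZMod.intCast_zmod_eq_zero_iff_dvd] using this

theorem map_zmod_surjective (p : ℕ) :
    Function.Surjective (mapRingHom (Int.castRingHom (ZMod p))) :=
  map_surjective _ (ZMod.ringHom_surjective _)

/-- A version of Dedekind's criterion. -/
theorem map_eq_zero_of_dvd_aeval {R : Type*} [CommRing R] [IsDomain R] [CharZero R]
    [Algebra.IsIntegral ℤ R] {α : R} {F : ℤ[X]} (hF : F.Monic)
    (hker : ∀ q : ℤ[X], aeval α q = 0 ↔ F ∣ q) {p : ℕ} (hp : p.Prime) {A B H : ℤ[X]}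
    (hdec : F = A * B ^ 2 + C (p : ℤ) * H)
    (hsep : (A.map (Int.castRingHom (ZMod p))).Separable)
    (hcop : IsCoprime (B.map (Int.castRingHom (ZMod p))) (H.map (Int.castRingHom (ZMod p))))
    {v : ℤ[X]} (hv : v.degree < F.degree)
    (hdvd : (p : R) ∣ aeval α v) :
    v.map (Int.castRingHom (ZMod p)) = 0 := by
  have : Fact p.Prime := ⟨hp⟩
  set m := mapRingHom (Int.castRingHom (ZMod p)) with hm
  by_contra hv0
  have hFα : aeval α F = 0 := (hker F).2 dvd_rfl
  let I : Ideal ℤ[X] := (Ideal.span {(p : R)}).comap (aeval α : ℤ[X] →ₐ[ℤ] R).toRingHom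
  have hI : ∀ q, q ∈ I ↔ (p : R) ∣ aeval α q := fun q => by
    simp [I, Ideal.mem_comap, Ideal.mem_span_singleton]
  obtain ⟨u, hu⟩ := (IsPrincipalIdealRing.principal (I.map m)).principal
  rw [Ideal.submodule_span_eq] at hu
  have hFu : u ∣ m F := by
    rw [← Ideal.mem_span_singleton, ← hu]
    exact Ideal.mem_map_of_mem _ ((hI _).2 (by simp [hFα]))
  have hvu : u ∣ m v := by
    rw [← Ideal.mem_span_singleton, ← hu]
    exact Ideal.mem_map_of_mem _ ((hI _).2 hdvd)
  have hmF : (m F).Monic := hF.map _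
  obtain ⟨e, he⟩ := hFu
  have he0 : e ≠ 0 := by
    rintro rfl
    exact hmF.ne_zero (by simpa using he)
  have heu : ¬ IsUnit e := by
    intro h
    have h1 : m F ∣ m v := by
      rw [he]
      exact (IsUnit.mul_right_dvd h).2 hvu
    have h2 := degree_le_of_dvd h1 hv0
    have h3 : (m F).degree = F.degree := hF.degree_map _
    have h4 : (m v).degree ≤ v.degree := degree_map_le
    exact absurd (h3 ▸ h2.trans h4) (not_le.2 hv)
  obtain ⟨g, hg, e', rfl⟩ := WfDvdMonoid.exists_irreducible_factor heu he0
  have hw : u * e' ∈ I.map m := by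
    rw [hu]
    exact Ideal.mem_span_singleton.2 (dvd_mul_right _ _)
  obtain ⟨w, hwI, hwm⟩ := (Ideal.mem_map_iff_of_surjective m (map_zmod_surjective p)).1 hw
  rw [hI] at hwI
  have hFg : m F = g * m w := by rw [he, hwm]; ring
  -- a maximal ideal of the ring of integers above `(p, g)`
  have : Fact (Irreducible g) := ⟨hg⟩
  let ψ : ℤ[X] →+* AdjoinRoot g := (AdjoinRoot.mk g).comp m
  have hψ : Function.Surjective ψ := AdjoinRoot.mk_surjective.comp (map_zmod_surjective p)
  have hmax : (RingHom.ker ψ).IsMaximal := RingHom.ker_isMaximal_of_surjective ψ hψ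
  have hmem : ∀ q, q ∈ RingHom.ker ψ ↔ g ∣ m q := fun q => by
    simp [ψ, RingHom.mem_ker, AdjoinRoot.mk_eq_zero]
  obtain ⟨P, hP⟩ : ∃ P : Ideal R, ∀ q : ℤ[X], aeval α q ∈ P ↔ g ∣ m q := by
    let _ : Algebra ℤ[X] R := (aeval α : ℤ[X] →ₐ[ℤ] R).toRingHom.toAlgebra
    have : IsScalarTower ℤ ℤ[X] R := IsScalarTower.of_algebraMap_eq fun x => by
      simp [RingHom.algebraMap_toAlgebra]
    have : Algebra.IsIntegral ℤ[X] R := Algebra.IsIntegral.tower_top ℤ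
    obtain ⟨P, -, hP⟩ := Ideal.exists_ideal_over_maximal_of_isIntegral (S := R) (RingHom.ker ψ)
      (fun q hq => by
        rw [hmem]
        have hq' : aeval α q = 0 := hq
        obtain ⟨r, rfl⟩ := (hker q).1 hq'
        rw [map_mul, hFg, mul_assoc]
        exact dvd_mul_right _ _)
    refine ⟨P, fun q => ?_⟩
    rw [← hmem, ← hP]
    rfl
  have hpP : (p : R) ∈ P := by
    have := (hP (C (p : ℤ))).2 (by simp)
    simpa using this
  have hgp : Prime g := hg.prime
  have hgw : g ∣ m w := by
    obtain ⟨x, hx⟩ := hwI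
    exact (hP w).1 (hx ▸ P.mul_mem_right _ hpP)
  have hdec' : m F = m A * m B ^ 2 := by rw [hdec]; simp
  have hgB : g ∣ m B := by
    by_contra hgB
    have h2 : g ^ 2 ∣ m A * m B ^ 2 := by
      rw [← hdec', hFg, sq]
      exact mul_dvd_mul_left _ hgw
    have h3 : g ^ 2 ∣ m A := by
      refine IsCoprime.dvd_of_dvd_mul_right (IsCoprime.pow ?_) h2
      exact (hg.coprime_iff_not_dvd).2 hgB
    exact hg.not_isUnit (hsep.squarefree g (by rwa [← sq]))
  obtain ⟨c, hc⟩ := hgB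
  obtain ⟨G, rfl⟩ := map_zmod_surjective p g
  obtain ⟨c, rfl⟩ := map_zmod_surjective p c
  obtain ⟨D, hD⟩ := exists_eq_C_mul_of_map_zmod_eq_zero (p := p) (q := B - G * c) (by
    change m _ = 0
    rw [map_sub, map_mul, hc, sub_self])
  obtain ⟨E, hE⟩ := exists_eq_C_mul_of_map_zmod_eq_zero (p := p) (q := w - A * G * c ^ 2) (by
    change m _ = 0
    apply mul_left_cancel₀ hgp.ne_zero
    rw [map_sub, mul_sub, ← hm, ← hFg, hdec', hc]
    simp only [map_mul, map_pow]
    ring)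
  obtain ⟨x, hx⟩ := hwI
  have hE' := congrArg (aeval α) hE
  have hD' := congrArg (aeval α) hD
  have hF' := congrArg (aeval α) hdec
  simp only [map_sub, map_mul, map_pow, map_add, hFα, hx, map_natCast]
    at hE' hD' hF'
  have hp0 : (p : R) ≠ 0 := Nat.cast_ne_zero.2 hp.ne_zero
  have key : aeval α H = aeval α G * (aeval α E - x - 2 * aeval α A * aeval α c * aeval α D)
      + p * (-(aeval α A * aeval α D ^ 2)) := by
    apply mul_left_cancel₀ hp0
    have hB : aeval α B = aeval α G * aeval α c + p * aeval α D := by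
      linear_combination hD'
    rw [hB] at hF'
    linear_combination -hF' + aeval α G * hE'
  have hH : m G ∣ m H := by
    rw [← hP, key]
    refine P.add_mem (P.mul_mem_right _ ((hP G).2 dvd_rfl)) (P.mul_mem_right _ hpP)
  exact hg.not_isUnit (hcop.isUnit_of_dvd' ⟨_, hc⟩ hH)

/-- If `F = A * B ^ 2 + p * H` with `A` separable and `B`, `H` coprime modulo `p`, then any two
complementary factors of `F` are coprime modulo `p`. -/
theorem isCoprime_map_of_mul_eq {F : ℤ[X]} {p : ℕ} (hp : p.Prime) {A B H : ℤ[X]}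
    (hdec : F = A * B ^ 2 + C (p : ℤ) * H)
    (hsep : (A.map (Int.castRingHom (ZMod p))).Separable)
    (hcop : IsCoprime (B.map (Int.castRingHom (ZMod p))) (H.map (Int.castRingHom (ZMod p))))
    {P Q : ℤ[X]} (hP : P.Monic) (hPQ : P * Q = F) :
    IsCoprime (P.map (Int.castRingHom (ZMod p))) (Q.map (Int.castRingHom (ZMod p))) := by
  have : Fact p.Prime := ⟨hp⟩
  set m := mapRingHom (Int.castRingHom (ZMod p)) with hm
  change IsCoprime (m P) (m Q)
  refine isCoprime_of_irreducible_dvd (fun h => (hP.map _).ne_zero h.1) fun g hg hgP hgQ => ?_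
  have hdec' : m P * m Q = m A * m B ^ 2 := by rw [← map_mul, hPQ, hdec]; simp
  have hgB : g ∣ m B := by
    by_contra hgB
    have h2 : g ^ 2 ∣ m A * m B ^ 2 := by
      rw [← hdec', sq]
      exact mul_dvd_mul hgP hgQ
    have h3 : g ^ 2 ∣ m A := by
      refine IsCoprime.dvd_of_dvd_mul_right (IsCoprime.pow ?_) h2
      exact (hg.coprime_iff_not_dvd).2 hgB
    exact hg.not_isUnit (hsep.squarefree g (by rwa [← sq]))
  have lift : ∀ T : ℤ[X], g ∣ m T → ∀ G : ℤ[X], m G = g → ∃ c D, T = G * c + C (p : ℤ) * D := by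
    rintro T ⟨c, hc⟩ G rfl
    obtain ⟨c, rfl⟩ := map_zmod_surjective p c
    obtain ⟨D, hD⟩ := exists_eq_C_mul_of_map_zmod_eq_zero (p := p) (q := T - G * c) (by
      change m _ = 0
      rw [map_sub, map_mul, hc, sub_self])
    exact ⟨c, D, by rw [← hD]; ring⟩
  obtain ⟨G, hG⟩ := map_zmod_surjective p g
  obtain ⟨b, b', hb⟩ := lift B hgB G hG
  obtain ⟨q, q', hq⟩ := lift Q hgQ G hG
  obtain ⟨r, r', hr⟩ := lift P hgP G hG
  have hS : m (r * q - A * b ^ 2) = 0 := by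
    have hg2 : g ^ 2 ≠ 0 := pow_ne_zero _ hg.ne_zero
    apply mul_left_cancel₀ hg2
    have hb' := congrArg m hb
    have hq' := congrArg m hq
    have hr' := congrArg m hr
    have hG' : m G = g := hG
    have hmp : m (C (p : ℤ)) = 0 := by simp
    simp only [map_add, map_mul, hG', hmp, zero_mul, add_zero] at hb' hq' hr'
    rw [hb', hq', hr'] at hdec'
    simp only [map_sub, map_mul, map_pow]
    linear_combination hdec'
  obtain ⟨S, hS⟩ := exists_eq_C_mul_of_map_zmod_eq_zero (p := p) hS
  have hp0 : (C (p : ℤ)) ≠ 0 := C_ne_zero.2 (Nat.cast_ne_zero.2 hp.ne_zero)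
  have key : H = G * (G * S + r * q' + r' * q - 2 * A * b * b') +
      C (p : ℤ) * (r' * q' - A * b' ^ 2) := by
    apply mul_left_cancel₀ hp0
    rw [hdec, hb, hr, hq] at hPQ
    linear_combination -hPQ + G ^ 2 * hS
  have hH : g ∣ m H := by
    have hG' : m G = g := hG
    rw [key, map_add, map_mul, hG', map_mul m (C (p : ℤ))]
    exact dvd_add (dvd_mul_right _ _) (by simp)
  exact hg.not_isUnit (hcop.isUnit_of_dvd' hgB hH)

/-- A Bézout identity modulo `p` for `A` and its derivative makes `A` separable modulo `p`. -/
theorem separable_map_zmod_of_eq {p : ℕ} {A a b t : ℤ[X]}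
    (h : a * A + b * derivative A = 1 + C (p : ℤ) * t) :
    (A.map (Int.castRingHom (ZMod p))).Separable := by
  refine ⟨a.map (Int.castRingHom _), b.map (Int.castRingHom _), ?_⟩
  rw [derivative_map, ← Polynomial.map_mul, ← Polynomial.map_mul, ← Polynomial.map_add, h]
  simp

theorem isCoprime_map_zmod_of_eq {p : ℕ} {B H c d u : ℤ[X]}
    (h : c * B + d * H = 1 + C (p : ℤ) * u) :
    IsCoprime (B.map (Int.castRingHom (ZMod p))) (H.map (Int.castRingHom (ZMod p))) := by
  refine ⟨c.map (Int.castRingHom _), d.map (Int.castRingHom _), ?_⟩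
  rw [← Polynomial.map_mul, ← Polynomial.map_mul, ← Polynomial.map_add, h]
  simp

/-- The integral form of `f17`. -/
noncomputable def f17Int : ℤ[X] :=
  X ^ 17 - 2 * X ^ 16 + 12 * X ^ 15 - 28 * X ^ 14 + 60 * X ^ 13 - 160 * X ^ 12 +
    200 * X ^ 11 - 500 * X ^ 10 + 705 * X ^ 9 - 886 * X ^ 8 + 2024 * X ^ 7 - 604 * X ^ 6 +
    2146 * X ^ 5 + 80 * X ^ 4 - 1376 * X ^ 3 - 496 * X ^ 2 - 1013 * X - 490

theorem f17Int_dedekind_two : ∃ H : ℤ[X],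
    f17Int = X * ((X ^ 2 + X + 1) ^ 4) ^ 2 + C ((2 : ℕ) : ℤ) * H ∧
    IsCoprime (((X ^ 2 + X + 1) ^ 4 : ℤ[X]).map (Int.castRingHom (ZMod 2)))
      (H.map (Int.castRingHom (ZMod 2))) := by
  refine ⟨-5 * X ^ 16 - 12 * X ^ 15 - 70 * X ^ 14 - 103 * X ^ 13 - 332 * X ^ 12 - 292 * X ^ 11 - 758 *
    X ^ 10 - 201 * X ^ 9 - 951 * X ^ 8 + 620 * X ^ 7 - 554 * X ^ 6 + 940 * X ^ 5 - 16 * X ^ 4 -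
    706 * X ^ 3 - 252 * X ^ 2 - 507 * X - 245,
    ?_, isCoprime_map_zmod_of_eq
      (c := X ^ 11 + X ^ 8 + X ^ 7 + X ^ 3 + 1)
      (d := X ^ 3)
      (u := -2 * X ^ 19 - 4 * X ^ 18 - 30 * X ^ 17 - 43 * X ^ 16 - 154 * X ^ 15 - 131 * X ^ 14 - 361 *
      X ^ 13 - 81 * X ^ 12 - 457 * X ^ 11 + 325 * X ^ 10 - 265 * X ^ 9 + 481 * X ^ 8 + 4 * X ^ 7
      - 340 * X ^ 6 - 113 * X ^ 5 - 242 * X ^ 4 - 114 * X ^ 3 + 5 * X ^ 2 + 2 * X) ?_⟩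
  · rw [f17Int]
    simp only [Nat.cast_ofNat, map_ofNat]
    ring
  · simp only [Nat.cast_ofNat, map_ofNat]
    ring

theorem f17Int_dedekind_three : ∃ A B H : ℤ[X], f17Int = A * B ^ 2 + C ((3 : ℕ) : ℤ) * H ∧
    (A.map (Int.castRingHom (ZMod 3))).Separable ∧
    IsCoprime (B.map (Int.castRingHom (ZMod 3))) (H.map (Int.castRingHom (ZMod 3))) := by
  refine ⟨X ^ 5 - X ^ 4 - X ^ 2 - 1,
    X ^ 6 + X ^ 5 - X ^ 4 - X ^ 3 + X ^ 2 + X + 1,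
    -X ^ 16 + 5 * X ^ 15 - 8 * X ^ 14 + 19 * X ^ 13 - 55 * X ^ 12 + 67 * X ^ 11 - 165 * X ^ 10 +
    236 * X ^ 9 - 295 * X ^ 8 + 675 * X ^ 7 - 201 * X ^ 6 + 715 * X ^ 5 + 27 * X ^ 4 - 458 * X ^
    3 - 164 * X ^ 2 - 337 * X - 163,
    ?_, separable_map_zmod_of_eq (a := -X ^ 3 + X ^ 2 - 1)
      (b := -X ^ 4 - X ^ 2)
      (t := -2 * X ^ 8 + 2 * X ^ 7 - 2 * X ^ 6 + 2 * X ^ 5 + X ^ 3) ?_,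
    isCoprime_map_zmod_of_eq
      (c := -X ^ 15 + X ^ 14 + X ^ 13 - X ^ 12 + X ^ 10 + X ^ 8 - X ^ 7 + X ^ 3 + X ^ 2 - X)
      (d := -X ^ 5 + X ^ 4 + X ^ 3 - X ^ 2 - 1)
      (u := -2 * X ^ 20 + 5 * X ^ 19 - 7 * X ^ 18 + 19 * X ^ 17 - 31 * X ^ 16 + 52 * X ^ 15 - 90 * X ^
      14 + 93 * X ^ 13 - 172 * X ^ 12 + 93 * X ^ 11 + 74 * X ^ 10 - 141 * X ^ 9 + 566 * X ^ 8 -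
      553 * X ^ 7 - 38 * X ^ 6 - 198 * X ^ 5 - 120 * X ^ 4 + 211 * X ^ 3 + 109 * X ^ 2 + 112 * X
      + 54) ?_⟩
  · rw [f17Int]
    simp only [Nat.cast_ofNat, map_ofNat]
    ring
  · simp only [derivative_sub, derivative_X_pow, derivative_one, map_ofNat, Nat.cast_ofNat]
    ring
  · simp only [Nat.cast_ofNat, map_ofNat]
    ring

theorem f17Int_dedekind_seventeen : ∃ A B H : ℤ[X], f17Int = A * B ^ 2 + C ((17 : ℕ) : ℤ) * H ∧
    (A.map (Int.castRingHom (ZMod 17))).Separable ∧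
    IsCoprime (B.map (Int.castRingHom (ZMod 17))) (H.map (Int.castRingHom (ZMod 17))) := by
  refine ⟨X - 5,
    X ^ 8 - 7 * X ^ 7 + 6 * X ^ 6 + 2 * X ^ 5 - 4 * X ^ 4 - X ^ 3 + 4 * X ^ 2 - 8 * X + 8,
    X ^ 16 - 7 * X ^ 15 + 21 * X ^ 14 - 20 * X ^ 13 - 14 * X ^ 12 + 36 * X ^ 11 - 30 * X ^ 10 +
    X ^ 9 + 14 * X ^ 8 + 63 * X ^ 7 - 31 * X ^ 6 + 154 * X ^ 5 - 112 * X ^ 3 + 16 * X ^ 2 - 101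
    * X - 10,
    ?_, separable_map_zmod_of_eq (a := 0)
      (b := 1)
      (t := 0) ?_,
    isCoprime_map_zmod_of_eq
      (c := -8 * X ^ 15 + 3 * X ^ 14 + 3 * X ^ 13 + 8 * X ^ 12 + 4 * X ^ 11 + 7 * X ^ 9 + 4 * X ^ 8 -
      X ^ 7 + X ^ 6 + X ^ 5 - 7 * X ^ 4 + 7 * X ^ 3 + 6 * X ^ 2 - 5 * X - 4)
      (d := 8 * X ^ 7 - 3 * X ^ 6 - 4 * X ^ 5 + 2 * X ^ 4 - 7 * X ^ 3 + 4 * X ^ 2 - 3 * X - 5)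
      (u := 7 * X ^ 21 - 12 * X ^ 20 - 9 * X ^ 19 + 31 * X ^ 18 - 30 * X ^ 17 + 10 * X ^ 16 + 12 * X ^
      15 + 7 * X ^ 14 - 3 * X ^ 13 + 55 * X ^ 12 - 16 * X ^ 11 - 114 * X ^ 10 + 70 * X ^ 9 - 101
      * X ^ 8 + 18 * X ^ 7 + 50 * X ^ 6 - 82 * X ^ 5 + 60 * X ^ 4 + 10 * X ^ 3 + 15 * X ^ 2 + 31
      * X + 1) ?_⟩
  · rw [f17Int]
    simp only [Nat.cast_ofNat, map_ofNat]
    ring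
  · simp
  · simp only [Nat.cast_ofNat, map_ofNat]
    ring

theorem f17Int_natDegree : f17Int.natDegree = 17 := by
  unfold f17Int
  compute_degree!

theorem f17Int_monic : f17Int.Monic := by
  unfold f17Int
  monicity!

theorem f17Int_map : f17Int.map (Int.castRingHom ℚ) = f17 := by
  simp [f17Int, f17]

theorem f17Int_eval_ne_zero (r : ℤ) : f17Int.eval r ≠ 0 := by
  intro h
  have h1 := congrArg (Int.cast : ℤ → ZMod 11) h
  simp only [f17Int, eval_add, eval_sub, eval_mul, eval_pow, eval_X, eval_ofNat] at h1
  push_cast at h1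
  revert h1
  generalize (r : ZMod 11) = x
  revert x
  decide +kernel

/-- The product of the two primes dividing the index of `ℤ[x]/(f17)`. -/
def f17Index : ℤ := 18450412015571167700169767

theorem exists_index_certificate : ∃ g k q : ℤ[X], g.coeff 16 = 1 ∧ g.natDegree < 17 ∧
    g ^ 2 = C (6228717797770484966008503 * f17Index) * g + C (f17Index ^ 2) * k + f17Int * q := by
  refine ⟨X ^ 16 - 9144945507488911338085573 * X ^ 15 - 6814851054954783309553927 * X ^ 14 -
    8416183710060863279472464 * X ^ 13 - 4311257369292409861345020 * X ^ 12 +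
    832287629086830916943630 * X ^ 11 - 3268954828610562966703308 * X ^ 10 +
    7365493723245245738072468 * X ^ 9 + 7827743309807002997974085 * X ^ 8 +
    3625085048612151602172648 * X ^ 7 - 1424572184785676026303462 * X ^ 6 +
    4766042184344451492938636 * X ^ 5 - 7420150819072215721316424 * X ^ 4 +
    996249438204175590306352 * X ^ 3 + 4427543591186059495868234 * X ^ 2 +
    2519969773214827121397611 * X - 6261070615594534010591857,
    -22166 * X ^ 16 + 3087263568643622868596675 * X ^ 15 + 2300641526017313276977765 * X ^ 14 +
    2841239166904279348231272 * X ^ 13 + 1455447470995107152468726 * X ^ 12 -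
    280973929676055554602746 * X ^ 11 + 1103574115520587903343468 * X ^ 10 -
    2486534273848530578285624 * X ^ 9 - 2642586194228376576311084 * X ^ 8 -
    1223800950443067767185916 * X ^ 7 + 480924659790511223674065 * X ^ 6 -
    1608979341680690767342970 * X ^ 5 + 2504986090819586755739745 * X ^ 4 -
    336326180766272522179568 * X ^ 3 - 1494704808952285588943451 * X ^ 2 -
    850722496767015471229039 * X + 2113689490702910433995134,
    X ^ 15 - 18289891014977822676171144 * X ^ 14 +
    83630028334941622138333021662765507598648699288175 * X ^ 13 +
    291902939748312871602657439530967201419188522075520 * X ^ 12 -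
    219381182802410499484034207484849507196324023344119 * X ^ 11 -
    1406394344913928793925171483819928185091697613444342 * X ^ 10 +
    3089636968532320822498957191377754692991025498793344 * X ^ 9 +
    12900974769432773988979811492419874637595067768374004 * X ^ 8 -
    7596981708238622856146867824183107498027064459378427 * X ^ 7 -
    50974438087470688318595928899871724469277446215182046 * X ^ 6 +
    70641329425718685425864732577318246510597250925340395 * X ^ 5 +
    300212703523079823152516020604942351882373866308392248 * X ^ 4 -
    231855272937578850876185444168067478641409637251097135 * X ^ 3 -
    1023867399134173946807444878149295472543806801298881614 * X ^ 2 +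
    1732609519257948987937121153431614068411126679361528014 * X +
    4669158880540170439571474255697227566629761276060249118,
    ?_, ?_, ?_⟩
  · simp [coeff_X, coeff_X_pow, coeff_ofNat_mul, coeff_ofNat_succ]
  · refine lt_of_le_of_lt (b := 16) ?_ (by norm_num)
    compute_degree
  · rw [f17Int]
    simp only [f17Index, map_ofNat, map_mul, map_pow]
    ring

attribute [irreducible] f17Int

theorem irreducible_X_sq_add_X_add_one : Irreducible (X ^ 2 + X + 1 : (ZMod 2)[X]) := by
  have hd : (X ^ 2 + X + 1 : (ZMod 2)[X]).natDegree = 2 := by compute_degree!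
  rw [irreducible_iff_roots_eq_zero_of_degree_le_three hd.ge (by rw [hd]; norm_num)]
  refine Multiset.eq_zero_of_forall_notMem fun x hx => ?_
  have := isRoot_of_mem_roots hx
  simp only [IsRoot.def, eval_add, eval_pow, eval_X, eval_one] at this
  clear hx
  revert this x
  decide

theorem f17Int_irreducible : Irreducible f17Int := by
  rw [f17Int_monic.irreducible_iff_natDegree']
  refine ⟨fun h => ?_, fun P Q hP hQ hPQ hdeg => ?_⟩
  · have := f17Int_natDegree
    rw [h, natDegree_one] at this
    lia
  obtain ⟨hdeg, hdeg'⟩ := Finset.mem_Ioc.1 hdeg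
  rw [f17Int_natDegree] at hdeg'
  obtain ⟨H, hdec, hcop⟩ := f17Int_dedekind_two
  have hco := isCoprime_map_of_mul_eq Nat.prime_two hdec (by simpa using separable_X) hcop hP hPQ
  set φ : (ZMod 2)[X] := X ^ 2 + X + 1 with hφ
  have hφi : Irreducible φ := irreducible_X_sq_add_X_add_one
  have hφd : (φ ^ 8).natDegree = 16 := by
    rw [natDegree_pow, show φ.natDegree = 2 by rw [hφ]; compute_degree!]
  have hdvd : φ ^ 8 ∣ P.map (Int.castRingHom (ZMod 2)) * Q.map (Int.castRingHom (ZMod 2)) := by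
    rw [← Polynomial.map_mul, hPQ, hdec]
    refine Dvd.intro_left X ?_
    simp only [Polynomial.map_add, Polynomial.map_mul, Polynomial.map_pow, map_X,
      Polynomial.map_one, Nat.cast_ofNat, eq_intCast, Int.cast_ofNat, hφ]
    rw [Polynomial.map_ofNat, show (2 : (ZMod 2)[X]) = 0 from CharTwo.two_eq_zero]
    ring
  have hsum : P.natDegree + Q.natDegree = 17 := by
    rw [← hP.natDegree_mul hQ, hPQ, f17Int_natDegree]
  have hle : ∀ T : ℤ[X], T.Monic → φ ^ 8 ∣ T.map (Int.castRingHom (ZMod 2)) →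
      16 ≤ T.natDegree := fun T hT h => by
    have := natDegree_le_of_dvd h (hT.map _).ne_zero
    rwa [hφd, hT.natDegree_map] at this
  by_cases hφQ : φ ∣ Q.map (Int.castRingHom (ZMod 2))
  · have hcoP : IsCoprime (φ ^ 8) (P.map (Int.castRingHom (ZMod 2))) :=
      (hco.symm.of_isCoprime_of_dvd_left hφQ).pow_left
    have := hle Q hQ (hcoP.dvd_of_dvd_mul_left hdvd)
    lia
  · have hcoQ : IsCoprime (φ ^ 8) (Q.map (Int.castRingHom (ZMod 2))) :=
      ((hφi.coprime_iff_not_dvd).2 hφQ).pow_left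
    have := hle P hP (hcoQ.dvd_of_dvd_mul_right hdvd)
    have hQ1 : Q.natDegree = 1 := by lia
    have hQX : Q = X + C (Q.coeff 0) := hQ.eq_X_add_C hQ1
    apply f17Int_eval_ne_zero (-Q.coeff 0)
    rw [← hPQ, eval_mul]
    have hQ0 : Q.eval (-Q.coeff 0) = 0 := by
      rw [hQX]
      simp
    rw [hQ0, mul_zero]

theorem f17_irreducible : Irreducible f17 := by
  rw [← f17Int_map]
  exact (f17Int_monic.irreducible_iff_irreducible_map_fraction_map (K := ℚ)).1 f17Int_irreducible

/-- The coefficients of `X ^ 17 - f17`. -/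
def powCoeff : Fin 17 → ℤ :=
  ![490, 1013, 496, 1376, -80, -2146, 604, -2024, 886, -705, 500, -200, 160, -60, 28, -12, 2]

/-- The matrix of multiplication by `f17'(x)` on `ℚ[x]/(f17)`, in the power basis. -/
def derivMatrix : Matrix (Fin 17) (Fin 17) ℤ :=
  !![-1013, 8330, 980, -9800, 9800, 47040, 35280, -62720, 131320, 435120, -695800, -176400,
      4410000, -129360, -15936760, -12371520, 20374200;
    -992, 16208, 10356, -19280, 10460, 107048, 119976, -94384, 208764, 1030864, -1003340,
      -1060480, 8940600, 4142568, -33076172, -41512984, 29749020;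
    -4128, 7440, 17200, 436, -9360, 58076, 142760, 56488, 38544, 649212, 326544, -1181900,
      3403520, 8809656, -11989336, -45599180, -20889304;
    320, 19264, 10192, -10320, 27956, 122736, 157148, -33368, 425256, 1260432, -1304708,
      -168816, 11202100, 3040256, -35943368, -46730584, 11614900;
    10730, -1040, 19104, 11792, -11920, 20276, 116976, 167388, -54808, 354216, 1374032,
      -1275908, -888816, 11223220, 5642176, -33923528, -50056984;
    -3624, -25752, -5332, 62024, -31128, -217936, -134236, 391664, -407740, -1960456, 3401536,
      2146592, -20589908, -322272, 81019724, 59824384, -123154208;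
    14168, 6644, -24544, -17412, 74104, 26856, -174448, -211548, 553536, 128612, -2818136,
      3184096, 7582592, -20749364, -19966768, 65769932, 84938704;
    -7088, -20240, 2596, 15936, -57892, -120200, -118872, 84624, -753980, -1243776, 3002692,
      -2089496, -15031904, 8116928, 45079212, 31135184, -18387988;
    6345, 7974, -18468, -15124, 33656, 27164, -56408, -232280, 322072, 32788, -2501896,
      2683732, 5884504, -15265808, -20699336, 22709484, 67975064;
    -5000, -5640, 6564, -4368, -29224, -34024, -23596, 33832, -421220, -303968, 1033888,
      -2248096, -3661268, 6070624, 7663612, -2899496, -6604416;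
    2200, 3500, -4640, -3436, 5632, 18776, 1976, -87596, 167832, 22780, -1013968, 853888,
      2251904, -3793268, -10191376, -4960388, 17890504;
    -1920, -1200, 3100, -640, -7436, -13568, 4376, 27576, -141196, -9768, 306780, -941968,
      -946112, 2304704, 2711532, -5141776, -13276388;
    780, 800, -880, -100, 2560, 7924, -2048, -16104, 70456, 884, -236968, 249180, 498032,
      -988352, -2899136, -1328148, 1511024;
    -392, -240, 680, 320, -1300, -3200, 3604, 5632, -32184, 17176, 86084, -215368, -290820,
      513872, 963088, -1384256, -3822948;
    180, 84, -184, 120, 880, 1388, -1184, 20, 13136, -7320, -22584, 76004, 36632, -298212,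
      -396800, 256144, -220016;
    -32, -24, 60, 56, -120, -272, 524, 352, -3196, 2480, 9720, -18264, -31996, 39800, 92076,
      -93824, -242816;
    17, 2, -20, 20, 96, 72, -128, 268, 888, -1420, -360, 9000, -264, -32524, -25248, 41580,
      -10664]

/-- A lower triangular matrix whose product with `derivMatrix` is upper triangular. -/
def elimMatrix : Matrix (Fin 17) (Fin 17) ℤ :=
  !![1, 0, 0, 0, 0, 0, 0, 0, 0, 0, 0, 0, 0, 0, 0, 0, 0;
    -992, 1013, 0, 0, 0, 0, 0, 0, 0, 0, 0, 0, 0, 0, 0, 0, 0;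
    -1240128, 559365, 169903, 0, 0, 0, 0, 0, 0, 0, 0, 0, 0, 0, 0, 0, 0;
    918781888, -2994178740, 639409512, 1874947525, 0, 0, 0, 0, 0, 0, 0, 0, 0, 0, 0, 0, 0;
    249577273701600, -81148447730164, 31442437518836, -50187771774407, 29653027694032, 0, 0,
      0, 0, 0, 0, 0, 0, 0, 0, 0, 0;
    -1260641574297133908, 880229885293250775, -326426157810905366, 75380168777623509,
      -127151440876391358, 113442533499080983, 0, 0, 0, 0, 0, 0, 0, 0, 0, 0, 0;
    22962788357658240945474, -13062754344721827077958, 6813637004572046561115,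
      -3388886464752713143996, 2230433629642838013709, -1249093489379690647408,
      780273988449913271703, 0, 0, 0, 0, 0, 0, 0, 0, 0, 0;
    -154535605303592940130203972, 87945408640979712088755399, -47057207200705729763641682,
      26181236893333905268059484, -14859456547040817380590930, 8454416346125786878841744,
      -4247108268431072140804150, 3058559028756860027704121, 0, 0, 0, 0, 0, 0, 0, 0, 0;
    625123422710264466922096386324, -361305535094223521754440661345,
      206941618901717368379870781526, -109769418823733263355734429388,
      59774022912838838244187893182, -34807575106934493517670784328,
      19998344328129579386175845498, -10075661189831489611107031063,
      6610781126108005418846189976, 0, 0, 0, 0, 0, 0, 0, 0;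
    -26064585561610858315944544943109367, 14837092423460311259551221539459610,
      -8648487577508284609212778492091328, 4807390365460384636172597644900219,
      -2475341751442473314266977807474551, 1425495717744440837935574206513064,
      -840793802231175661676116368023989, 471377607538641903909953668127849,
      -209531672822268200318162219052373, 122993623270923615131938548320055, 0, 0, 0, 0, 0, 0, 0;
    9185529798664158883927438203991645645, -5351971107767472276553719865301206320,
      3062644175085804034076365352065456054, -1603642150095195187247516722537492853,
      873086075830962567050375078817812615, -511814590709512962682793517173817198,
      305635560964126218106853820869251479, -170333180623484748147006095411336661,
      70207550409332074739267369207469475, 48494540908491812564578219270322853,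
      85434956693120699113197053285913194, 0, 0, 0, 0, 0, 0;
    -48365150809398664585279137546614239770331, 27341693821370018949736571852860259286345,
      -16152533065810958570162093773841254157545, 9118902679096197032830881396176509904952,
      -4596222770154554108993113217834214818814, 2600641185494355392257865663335920260520,
      -1542102887942372286440319433777401996634, 926069189376941996094886561885128694052,
      -510858811358280248032342054118801322323, 189873080360937578621844927504899826720,
      299796302072336012919092790608231140234, 406637524023524303534400880528812130337, 0, 0, 0,
      0, 0;
    7301583641024148344168447667039159558927556, -4076888848134621024997951203798446652526215,
      2398666185752539885770101852466258347676079, -1411453302553861304849204135896306900416525,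
      700978065259468173728190848721212884380642, -396142595769343693281560672851719821327904,
      195265768200773748516042382532937716043784, -129511247054613614964191121288202090597124,
      138132186788942323412556816089443884615644, -127152240754650166544907888425160144582861,
      -239955448893981986994935062826821883710258, 193198156817536396939230274543002743194888,
      577699425673230820760286742984241795598177, 0, 0, 0, 0;
    18345630245361466190786767512602142187814810,
      -5387448227447484425282127990486128220039468, 5119053722386151581866446353890407414706149,
      -7987147705353518024279469453882137753042421, 249260564460156303948565754913007688545575,
      3970909930379677812501283995144187866961122, 3495243428227598694677045667475316220836960,
      -15126697745048312428353135860289650404324096,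
      -7364234685623260350845552490631927575204212,
      40255579964049015922138923308532027969555636,
      10216532161700789188511762033551718172447031,
      -109316178113424634692769818902064552786586114,
      -3590181702833243601999236084614151116445352,
      228710808809001529659664539725996694812216517, 0, 0, 0;
    24031908991201988435883186443394279765310736356,
      -13468033325280430690795051406757343154836521862,
      8105393734771197315690539020628430877297729207,
      -4643337066237139671144349380435872014888274801,
      2089503881701090390062782906640222133146805266,
      -1378518803741241108863225044682256992123923126,
      1349050790862842877912088598660561900274775594,
      -304199974748520312459409708190410622322285177,
      -1564811096094163460906359442454070225701152180,
      -362630412764546304798096250076878271406957963,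
      4984885415748612338893859688622558523445313969,
      -400120518852050133154577270716838452182894318,
      -12761223659789555108270617829489003692763614780,
      2675988781392918683956437002680791592310207746,
      25703640074229533689733629289929040036027324393, 0, 0;
    -115794443759977938900685261822338505289529788445,
      63246857582199746590268599883665997779957635212,
      -40029925780981045370579677101176554577049544313,
      26063722212058197325306903674176097442488054317,
      -9231714053267416205961743016959000067200533816,
      -2931700613805563656524811379738882095646581965,
      -7590538013109893226855015889333036770078145454,
      31823095632455582340147403727407559263922371811,
      6312105544465803617996630401322316298843144863,
      -94346321084020975733532856176956719274110306501,
      -9682565727848489469023205577727011634204615796,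
      304651916712741693258075182660540648375073740414,
      -1339557348355697094961426771935480227727588,
      -965501818276782265260786569499262599389541424934,
      41071487652479397517944221591508635241136534754,
      3063227701767894708973447173072825123421615140709, 0;
    -719265405293655127165924376298188372006660092582,
      395536485550900086712505895957833902822677437775,
      -250394385732425222768871617204353197998536087822,
      159161366508375070879205588131901558716732089283,
      -53891604928048264016602412111522302373760509197,
      -12808948460771111559044133356214472057237908874,
      -59374804596527445716833318332896135103249225225,
      182981315338072227712700867202048616601129684824,
      80009256932975331809759183262244904361107257499,
      -545701704498107004183802605559218616396571994363,
      -195906934798187851182019795881474864132600683899,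
      1777114609110707354261712459928439839677657890286,
      439911543335649424659767898955028148565429125626,
      -5651300087350315861404324898213421625024116034912,
      -1146561658206285021319506895640980912227574229366,
      17865988537725582595310863893088290833381632649366,
      4456935574905678529041398119827343298478056000281]

theorem derivMatrix_zero_succ : ∀ j : Fin 16,
    derivMatrix 0 j.succ = derivMatrix (Fin.last 16) j.castSucc * powCoeff 0 := by
  decide +kernel

theorem derivMatrix_succ_succ : ∀ i j : Fin 16,
    derivMatrix i.succ j.succ =
      derivMatrix i.castSucc j.castSucc +
        derivMatrix (Fin.last 16) j.castSucc * powCoeff i.succ := by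
  decide +kernel

theorem elimMatrix_lower : ∀ j i : Fin 17, i < j → elimMatrix i j = 0 := by
  decide +kernel

theorem elimMatrix_mul_lower : ∀ i j : Fin 17, j < i → (elimMatrix * derivMatrix) i j = 0 := by
  decide +kernel

theorem prod_elimMatrix_ne_zero : ∏ i, elimMatrix i i ≠ 0 := by
  decide +kernel

theorem prod_elimMatrix_mul : ∏ i, (elimMatrix * derivMatrix) i i =
    (∏ i, elimMatrix i i) * (2 ^ 44 * 3 ^ 6 * 17 ^ 8 * f17Index ^ 2) := by
  decide +kernel

theorem det_derivMatrix : derivMatrix.det = 2 ^ 44 * 3 ^ 6 * 17 ^ 8 * f17Index ^ 2 := by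
  have h1 : elimMatrix.det = ∏ i, elimMatrix i i :=
    Matrix.det_of_isLowerTriangular _ fun i j hij => elimMatrix_lower j i hij
  have h2 : (elimMatrix * derivMatrix).det = ∏ i, (elimMatrix * derivMatrix) i i :=
    Matrix.det_of_isUpperTriangular fun i j hij => elimMatrix_mul_lower i j hij
  rw [Matrix.det_mul, h1, prod_elimMatrix_mul] at h2
  exact mul_left_cancel₀ prod_elimMatrix_ne_zero h2

open Module Matrix in
theorem dvd_det_toMatrix {n R : Type*} [Fintype n] [DecidableEq n] [CommRing R]
    (b : Basis n ℤ R) (v : n → R) {c : n → ℤ} {i : n} (hi : c i = 1) {m : ℤ} {y : R}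
    (h : ∑ j, c j • v j = m • y) : m ∣ (b.toMatrix v).det := by
  have h1 : b.toMatrix v *ᵥ c = m • ⇑(b.repr y) := by
    ext k
    simpa [-zsmul_eq_mul, Matrix.mulVec, dotProduct, Basis.toMatrix_apply, mul_comm] using
      congrArg (fun x => b.repr x k) h
  have h2 : (b.toMatrix v).det = ((b.toMatrix v).adjugate *ᵥ (b.toMatrix v *ᵥ c)) i := by
    rw [Matrix.mulVec_mulVec, Matrix.adjugate_mul, Matrix.smul_mulVec, Matrix.one_mulVec,
      Pi.smul_apply, hi, smul_eq_mul, mul_one]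
  rw [h2, h1, Matrix.mulVec_smul, Pi.smul_apply, smul_eq_mul]
  exact dvd_mul_right _ _

open Module Matrix in
theorem exists_sum_smul_eq_of_dvd_det_toMatrix {n R : Type*} [Fintype n] [DecidableEq n]
    [CommRing R] (b : Basis n ℤ R) (v : n → R) {p : ℕ} (hp : p.Prime)
    (h : (p : ℤ) ∣ (b.toMatrix v).det) :
    ∃ c : n → ℤ, (∃ i, (c i : ZMod p) ≠ 0) ∧ (p : R) ∣ ∑ j, c j • v j := by
  have := Fact.mk hp
  have hdet : ((b.toMatrix v).map (Int.castRingHom (ZMod p))).det = 0 := by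
    rw [← RingHom.mapMatrix_apply, ← RingHom.map_det, eq_intCast]
    exact (ZMod.intCast_zmod_eq_zero_iff_dvd _ _).2 h
  obtain ⟨w, hw0, hw⟩ := Matrix.exists_mulVec_eq_zero_iff.2 hdet
  choose c hc using fun i => ZMod.intCast_surjective (w i)
  refine ⟨c, ?_, ?_⟩
  · obtain ⟨i, hi⟩ := Function.ne_iff.1 hw0
    exact ⟨i, by rwa [hc]⟩
  have hdvd : ∀ k, (p : ℤ) ∣ b.repr (∑ j, c j • v j) k := fun k => by
    rw [← ZMod.intCast_zmod_eq_zero_iff_dvd]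
    simpa [-zsmul_eq_mul, Matrix.mulVec, dotProduct, Basis.toMatrix_apply, mul_comm, hc]
      using congrFun hw k
  choose d hd using hdvd
  refine ⟨∑ k, d k • b k, ?_⟩
  rw [← b.sum_repr (∑ j, c j • v j), Finset.mul_sum]
  refine Finset.sum_congr rfl fun k _ => ?_
  rw [hd, mul_smul, zsmul_eq_mul, Int.cast_natCast]

open NumberField Module in
theorem discr_eq_det_toMatrix_sq_mul_discr {K n : Type*} [Field K] [NumberField K] [Fintype n]
    [DecidableEq n] (b : Basis n ℤ (𝓞 K)) (v : n → 𝓞 K) :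
    Algebra.discr ℚ (fun i => (v i : K)) = (b.toMatrix v).det ^ 2 * NumberField.discr K := by
  have h1 : Algebra.discr ℤ v = (b.toMatrix v).det ^ 2 * NumberField.discr K := by
    rw [← NumberField.discr_eq_discr K b, ← Algebra.discr_of_matrix_vecMul,
      Basis.toMatrix_map_vecMul]
  rw [← Int.cast_pow, ← Int.cast_mul, ← h1, Algebra.discr_def, Algebra.discr_def,
    ← eq_intCast (Int.castRingHom ℚ), RingHom.map_det]
  congr 1
  ext i j
  simp [Algebra.traceMatrix_apply, Algebra.traceForm_apply, Algebra.coe_trace_int,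
    ← map_mul]

open NumberField in
theorem exists_ringOfIntegers_mul_eq {K : Type*} [Field K] [NumberField K] {y k : 𝓞 K} {m t : ℤ}
    (hm : m ≠ 0) (h : y ^ 2 = (t * m) * y + m ^ 2 * k) : ∃ z : 𝓞 K, y = m • z := by
  have hm' : (m : K) ≠ 0 := Int.cast_ne_zero.2 hm
  have hK : (y : K) ^ 2 = (t * m) * y + m ^ 2 * k := by
    simpa using congrArg (algebraMap (𝓞 K) K) h
  have hint : IsIntegral (𝓞 K) ((y : K) / m) := by
    refine ⟨X ^ 2 - (C (t : 𝓞 K) * X + C k), ?_, ?_⟩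
    · monicity!
    · simp only [eval₂_sub, eval₂_add, eval₂_mul, eval₂_pow, eval₂_X, eval₂_C]
      rw [map_intCast, div_pow, hK]
      field_simp
      ring
  obtain ⟨z, hz⟩ := IsIntegrallyClosed.algebraMap_eq_of_integral hint
  refine ⟨z, RingOfIntegers.coe_injective ?_⟩
  rw [zsmul_eq_mul, map_mul, hz, map_intCast, mul_div_cancel₀ _ hm']

theorem pow_seventeen_eq_sum {R : Type*} [CommRing R] {α : R} (hα : aeval α f17Int = 0) :
    α ^ 17 = ∑ i : Fin 17, (powCoeff i : R) * α ^ (i : ℕ) := by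
  unfold f17Int at hα
  simp only [map_add, map_sub, map_mul, map_pow, aeval_X, map_ofNat] at hα
  simp [Fin.sum_univ_succ, powCoeff]
  linear_combination hα

theorem aeval_derivative_eq_sum {R : Type*} [CommRing R] (α : R) :
    aeval α (derivative f17Int) = ∑ i : Fin 17, (derivMatrix i 0 : R) * α ^ (i : ℕ) := by
  unfold f17Int
  simp [Fin.sum_univ_succ, derivMatrix, map_ofNat]
  ring

theorem aeval_derivative_mul_pow {R : Type*} [CommRing R] {α : R} (hα : aeval α f17Int = 0)
    (j : Fin 17) : aeval α (derivative f17Int) * α ^ (j : ℕ) =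
      ∑ i : Fin 17, (derivMatrix i j : R) * α ^ (i : ℕ) := by
  induction j using Fin.induction with
  | zero => rw [Fin.val_zero, pow_zero, mul_one, aeval_derivative_eq_sum]
  | succ j ih =>
    rw [Fin.val_castSucc] at ih
    have h := pow_seventeen_eq_sum hα
    rw [Fin.sum_univ_succ] at h
    rw [Fin.val_succ, pow_succ, ← mul_assoc, ih, Fin.sum_univ_castSucc,
      Fin.sum_univ_succ (fun i => (derivMatrix i j.succ : R) * α ^ (i : ℕ)), add_mul,
      mul_assoc _ _ α, Fin.val_last, ← pow_succ, h, mul_add, Finset.sum_mul, Finset.mul_sum]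
    simp only [derivMatrix_zero_succ, derivMatrix_succ_succ, Int.cast_add, Int.cast_mul, add_mul,
      Finset.sum_add_distrib, Fin.val_zero, Fin.val_succ, Fin.val_castSucc, pow_succ, mul_assoc]
    ring

theorem aeval_f17 {A : Type*} [Ring A] [Algebra ℚ A] (α : A) :
    aeval α f17 = aeval α f17Int := by
  rw [← f17Int_map, ← algebraMap_int_eq, aeval_map_algebraMap]

open Module in
theorem exists_basis_pow {K : Type*} [Field K] [NumberField K] {α : K} (hα : aeval α f17 = 0)
    (hK : finrank ℚ K = 17) : ∃ b : Basis (Fin 17) ℚ K, ∀ i, b i = α ^ (i : ℕ) := by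
  have hmin : f17 = minpoly ℚ α :=
    minpoly.eq_of_irreducible_of_monic f17_irreducible hα (f17Int_map ▸ f17Int_monic.map _)
  have hdeg : (minpoly ℚ α).natDegree = 17 := by
    rw [← hmin, ← f17Int_map, f17Int_monic.natDegree_map, f17Int_natDegree]
  have hli : LinearIndependent ℚ fun i : Fin 17 => α ^ (i : ℕ) := hdeg ▸ linearIndependent_pow α
  exact ⟨basisOfLinearIndependentOfCardEqFinrank hli (by simp [hK]), fun i => by simp⟩

theorem discr_pow_eq {K : Type*} [Field K] [NumberField K] {α : K} (hα : aeval α f17 = 0)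
    (hK : Module.finrank ℚ K = 17) : Algebra.discr ℚ (fun i : Fin 17 => α ^ (i : ℕ)) =
      (2 ^ 44 * 3 ^ 6 * 17 ^ 8 * f17Index ^ 2 : ℤ) := by
  obtain ⟨b, hb⟩ := exists_basis_pow hα hK
  have hmin : f17 = minpoly ℚ α :=
    minpoly.eq_of_irreducible_of_monic f17_irreducible hα (f17Int_map ▸ f17Int_monic.map _)
  have hmat : Algebra.leftMulMatrix b (aeval α (derivative f17)) =
      derivMatrix.map (Int.castRingHom ℚ) := by
    ext i j
    have h : aeval α (derivative f17) * b j = ∑ i, (derivMatrix i j : ℚ) • b i := by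
      rw [← f17Int_map, derivative_map, ← algebraMap_int_eq, aeval_map_algebraMap, hb,
        aeval_derivative_mul_pow (by rwa [← aeval_f17])]
      simp [hb, Algebra.smul_def]
    rw [Algebra.leftMulMatrix_eq_repr_mul, h, b.repr_sum_self]
    rfl
  have h := Algebra.discr_powerBasis_eq_norm ℚ (⟨α, 17, b, hb⟩ : PowerBasis ℚ K)
  rw [hK] at h
  change Algebra.discr ℚ b = _ * Algebra.norm ℚ (aeval α (derivative (minpoly ℚ α))) at h
  rw [← hmin, Algebra.norm_eq_matrix_det b, hmat, ← RingHom.mapMatrix_apply, ← RingHom.map_det,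
    det_derivMatrix, eq_intCast] at h
  rw [← funext hb, h]
  norm_num

theorem eq_of_sq_mul_eq {n d : ℤ} (h : n ^ 2 * d = 2 ^ 44 * 3 ^ 6 * 17 ^ 8)
    (h2 : ¬ (2 : ℤ) ∣ n) (h3 : ¬ (3 : ℤ) ∣ n) (h17 : ¬ (17 : ℤ) ∣ n) :
    d = 2 ^ 44 * 3 ^ 6 * 17 ^ 8 := by
  have hn : n.natAbs = 1 := by
    by_contra hne
    obtain ⟨p, hp, hpn⟩ := Nat.exists_prime_and_dvd hne
    have hpn' : (p : ℤ) ∣ n := Int.natCast_dvd.2 hpn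
    have hpT : p ∣ 2 ^ 44 * 3 ^ 6 * 17 ^ 8 := by
      rw [← Int.natCast_dvd_natCast]
      rw [show ((2 ^ 44 * 3 ^ 6 * 17 ^ 8 : ℕ) : ℤ) = 2 ^ 44 * 3 ^ 6 * 17 ^ 8 by norm_num, ← h]
      exact (dvd_pow hpn' two_ne_zero).mul_right d
    have key : ∀ q k, q.Prime → p ∣ q ^ k → p = q := fun q k hq hd =>
      (Nat.prime_dvd_prime_iff_eq hp hq).1 (hp.dvd_of_dvd_pow hd)
    rcases hp.dvd_mul.1 hpT with h' | h'
    · rcases hp.dvd_mul.1 h' with h' | h'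
      · exact h2 (by simpa [key 2 44 (by norm_num) h'] using hpn')
      · exact h3 (by simpa [key 3 6 (by norm_num) h'] using hpn')
    · exact h17 (by simpa [key 17 8 (by norm_num) h'] using hpn')
  rwa [← Int.natAbs_sq, hn, Nat.cast_one, one_pow, one_mul] at h

theorem aeval_eq_zero_iff_f17Int_dvd {R : Type*} [CommRing R] [IsDomain R] [CharZero R]
    {θ : R} (hθ : aeval θ f17Int = 0) (q : ℤ[X]) : aeval θ q = 0 ↔ f17Int ∣ q := by
  have hint : IsIntegral ℤ θ := ⟨f17Int, f17Int_monic, hθ⟩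
  have h : minpoly ℤ θ = f17Int := by
    refine eq_of_monic_of_associated (minpoly.monic hint) f17Int_monic ?_
    exact (minpoly.irreducible hint).associated_of_dvd f17Int_irreducible
      (minpoly.isIntegrallyClosed_dvd hint hθ)
  rw [← h, minpoly.isIntegrallyClosed_dvd_iff hint]

open Module in
theorem not_dvd_det_toMatrix_pow {R : Type*} [CommRing R] [IsDomain R] [CharZero R]
    [Algebra.IsIntegral ℤ R] {θ : R} (hθ : aeval θ f17Int = 0) (b : Basis (Fin 17) ℤ R)
    {p : ℕ} (hp : p.Prime) {A B H : ℤ[X]} (hdec : f17Int = A * B ^ 2 + C (p : ℤ) * H)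
    (hsep : (A.map (Int.castRingHom (ZMod p))).Separable)
    (hcop : IsCoprime (B.map (Int.castRingHom (ZMod p))) (H.map (Int.castRingHom (ZMod p)))) :
    ¬ (p : ℤ) ∣ (b.toMatrix fun i : Fin 17 => θ ^ (i : ℕ)).det := by
  intro hdvd
  obtain ⟨c, ⟨i, hi⟩, hc⟩ := exists_sum_smul_eq_of_dvd_det_toMatrix b _ hp hdvd
  set v : ℤ[X] := ∑ j : Fin 17, monomial (j : ℕ) (c j) with hv
  have hdeg : v.degree < f17Int.degree := by
    rw [degree_eq_natDegree f17Int_monic.ne_zero, f17Int_natDegree]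
    refine (degree_sum_le _ _).trans_lt ((Finset.sup_lt_iff (WithBot.bot_lt_coe _)).2 fun j _ => ?_)
    exact (degree_monomial_le _ _).trans_lt (by exact_mod_cast j.2)
  have haeval : aeval θ v = ∑ j : Fin 17, c j • θ ^ (j : ℕ) := by
    simp [hv, aeval_monomial]
  have h0 := map_eq_zero_of_dvd_aeval f17Int_monic (aeval_eq_zero_iff_f17Int_dvd hθ) hp hdec hsep
    hcop hdeg (haeval ▸ hc)
  apply hi
  have := congrArg (coeff · (i : ℕ)) h0
  simpa [hv, coeff_monomial, Fin.val_inj] using this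

open Module in
theorem f17Index_dvd_det_toMatrix_pow {K : Type*} [Field K] [NumberField K]
    {θ : NumberField.RingOfIntegers K} (hθ : aeval θ f17Int = 0)
    (b : Basis (Fin 17) ℤ (NumberField.RingOfIntegers K)) :
    f17Index ∣ (b.toMatrix fun i : Fin 17 => θ ^ (i : ℕ)).det := by
  obtain ⟨g, k, q, hg, hdeg, hgk⟩ := exists_index_certificate
  have hrel := congrArg (aeval θ) hgk
  simp only [map_add, map_mul, map_pow, hθ, zero_mul, add_zero, eq_intCast,
    map_intCast] at hrel
  obtain ⟨z, hz⟩ := exists_ringOfIntegers_mul_eq (K := K) (by decide : f17Index ≠ 0)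
    hrel
  refine dvd_det_toMatrix b _ (c := fun i => g.coeff i) (i := Fin.last 16) hg (y := z) ?_
  rw [← hz, aeval_eq_sum_range' hdeg, Fin.sum_univ_eq_sum_range (fun i => g.coeff i • θ ^ i)]

open Module in
theorem discr_eq_of_aeval_f17_eq_zero {K : Type*} [Field K] [NumberField K] {α : K}
    (hα : aeval α f17 = 0) (hK : finrank ℚ K = 17) :
    NumberField.discr K = 2 ^ 44 * 3 ^ 6 * 17 ^ 8 := by
  have hα' : aeval α f17Int = 0 := by rwa [← aeval_f17]
  have hint : IsIntegral ℤ α := ⟨f17Int, f17Int_monic, hα'⟩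
  set θ : NumberField.RingOfIntegers K := ⟨α, hint⟩
  have hθ : aeval θ f17Int = 0 := by
    refine NumberField.RingOfIntegers.coe_injective ?_
    rw [map_zero, ← hα', ← aeval_algebraMap_apply]
    rfl
  let b : Basis (Fin 17) ℤ (NumberField.RingOfIntegers K) :=
    finBasisOfFinrankEq _ _ ((NumberField.RingOfIntegers.rank K).trans hK)
  obtain ⟨n, hn⟩ := f17Index_dvd_det_toMatrix_pow hθ b
  have hdiscr := discr_eq_det_toMatrix_sq_mul_discr b fun i => θ ^ (i : ℕ)
  have hcoe : (fun i : Fin 17 => ((θ ^ (i : ℕ) : NumberField.RingOfIntegers K) : K)) =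
      fun i : Fin 17 => α ^ (i : ℕ) := rfl
  rw [hcoe, discr_pow_eq hα hK, hn] at hdiscr
  have hndvd : ∀ {p : ℕ}, ¬ (p : ℤ) ∣ (b.toMatrix fun i : Fin 17 => θ ^ (i : ℕ)).det →
      ¬ (p : ℤ) ∣ n :=
    fun h h' => h (hn ▸ h'.mul_left _)
  refine eq_of_sq_mul_eq (n := n) ?_ (hndvd (p := 2) ?_) (hndvd (p := 3) ?_) (hndvd (p := 17) ?_)
  · have h0 : f17Index ^ 2 ≠ 0 := pow_ne_zero 2 (by decide)
    refine mul_right_cancel₀ h0 ?_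
    have : 2 ^ 44 * 3 ^ 6 * 17 ^ 8 * f17Index ^ 2 = (f17Index * n) ^ 2 * NumberField.discr K := by
      exact_mod_cast hdiscr
    rw [this]
    ring
  · obtain ⟨H, hdec, hcop⟩ := f17Int_dedekind_two
    exact not_dvd_det_toMatrix_pow hθ b Nat.prime_two hdec (by simpa using separable_X) hcop
  · obtain ⟨A, B, H, hdec, hsep, hcop⟩ := f17Int_dedekind_three
    exact not_dvd_det_toMatrix_pow hθ b Nat.prime_three hdec hsep hcop
  · obtain ⟨A, B, H, hdec, hsep, hcop⟩ := f17Int_dedekind_seventeen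
    exact not_dvd_det_toMatrix_pow hθ b (by norm_num) hdec hsep hcop

/-- The field `L = ℚ[x]/(f17)` is a number field of degree 17 over `ℚ` whose ring of
integers has discriminant `2⁴⁴ · 3⁶ · 17⁸ = 89462021750334834736103424`. -/
theorem stmt_16 (L : Type) [Field L] [NumberField L]
    (h : Nonempty (L ≃+* AdjoinRoot f17)) :
    Irreducible f17 ∧ Module.finrank ℚ L = 17 ∧
      NumberField.discr L = 2 ^ 44 * 3 ^ 6 * 17 ^ 8 ∧
      (2 ^ 44 * 3 ^ 6 * 17 ^ 8 : ℤ) = 89462021750334834736103424 := by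
  obtain ⟨e⟩ := h
  have : Fact (Irreducible f17) := ⟨f17_irreducible⟩
  let e' : AdjoinRoot f17 ≃ₐ[ℚ] L := e.symm.toRatAlgEquiv
  have hK : Module.finrank ℚ L = 17 := by
    rw [← e'.toLinearEquiv.finrank_eq,
      (AdjoinRoot.powerBasis f17_irreducible.ne_zero).finrank, AdjoinRoot.powerBasis_dim,
      ← f17Int_map, f17Int_monic.natDegree_map, f17Int_natDegree]
  have hα : aeval (e' (AdjoinRoot.root f17)) f17 = 0 := by
    rw [aeval_algHom_apply, aeval_def, Subsingleton.elim (algebraMap ℚ _) (AdjoinRoot.of f17),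
      AdjoinRoot.eval₂_root, map_zero]
  exact ⟨f17_irreducible, hK, discr_eq_of_aeval_f17_eq_zero hα hK, by norm_num⟩
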